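/- Let N ≥ 1, m ≥ 1, 0 < p ≤ 1, set N_p := ⌊N(1/p − 1)⌋, and let T > 0. There exists a constant C = C(m,N,p,T) > 0 such that for every f ∈ L^1_loc(ℝ^N), every x ∈ ℝ^N and every 0 < t < T there exists a polynomial P of degree at most m−1 satisfying |f(y) − P(y)| ≤ C t^m Σ_{|β|=m} sup{ |∫_{B(x,t)} f(z) ∂^β ψ(z) dz| : ψ ∈ 𝓕_{N_p}(y,s) for some 0 < s < 2√N·t } for almost every y ∈ B(x,t). -/

import Mathlib

open MeasureTheory Set Metric Filter
open scoped ENNReal NNReal Topology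

noncomputable section

abbrev RN (N : ℕ) := EuclideanSpace ℝ (Fin N)

variable {N : ℕ}

/-- Partial derivative in the `i`-th coordinate direction. -/
def pd {E : Type*} [NormedAddCommGroup E] [NormedSpace ℝ E] (i : Fin N)
    (f : RN N → E) : RN N → E :=
  fun x => fderiv ℝ f x (EuclideanSpace.single i 1)

/-- Multi-index partial derivative `∂^α`. -/
def md {E : Type*} [NormedAddCommGroup E] [NormedSpace ℝ E] (α : Fin N → ℕ)
    (f : RN N → E) : RN N → E :=
  ((List.ofFn fun i : Fin N => (pd i)^[α i]).foldr (· ∘ ·) id) f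

/-- Order `|α|` of a multi-index. -/
def mOrder (α : Fin N → ℕ) : ℕ := ∑ i, α i

/-- Multi-indices of order at most `k`. -/
def idxLe (N k : ℕ) : Finset (Fin N → ℕ) :=
  (Fintype.piFinset fun _ : Fin N => Finset.range (k + 1)).filter fun α => mOrder α ≤ k

/-- Multi-indices of order exactly `k`. -/
def idxEq (N k : ℕ) : Finset (Fin N → ℕ) :=
  (Fintype.piFinset fun _ : Fin N => Finset.range (k + 1)).filter fun α => mOrder α = k

/-- The dilate `φ_t(z) = t^{-N} φ(z/t)`. -/
def dil (φ : RN N → ℝ) (t : ℝ) (z : RN N) : ℝ := φ (t⁻¹ • z) / t ^ N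

/-- Convolution `(u * φ_t)(x)`. -/
def convAt (φ : RN N → ℝ) (t : ℝ) (u : RN N → ℂ) (x : RN N) : ℂ :=
  ∫ y, dil φ t (x - y) • u y

/-- The small maximal function `sup_{0<t<1} |(u * φ_t)(x)|`. -/
def smallMax (φ : RN N → ℝ) (u : RN N → ℂ) (x : RN N) : ℝ≥0∞ :=
  ⨆ t ∈ Ioo (0 : ℝ) 1, ENNReal.ofReal ‖convAt φ t u x‖

/-- The localizable Hardy space quasi-norm `‖u‖_{h^p}` (for `0 < p < ∞`). -/
def hNorm (φ : RN N → ℝ) (p : ℝ) (u : RN N → ℂ) : ℝ≥0∞ :=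
  (∫⁻ x, smallMax φ u x ^ p) ^ (1 / p)

/-- A fixed radial nonnegative smooth function supported in the unit ball with integral 1. -/
structure GoodPhi (φ : RN N → ℝ) : Prop where
  smooth : ContDiff ℝ (⊤ : ℕ∞) φ
  nonneg : ∀ x, 0 ≤ φ x
  radial : ∀ x y : RN N, ‖x‖ = ‖y‖ → φ x = φ y
  supp : tsupport φ ⊆ closedBall 0 1
  int_one : ∫ x, φ x = 1

/-- The closed axes-parallel cube with center `c` and side length `ℓ`. -/
def cube (c : RN N) (ℓ : ℝ) : Set (RN N) := {y | ∀ i, |y i - c i| ≤ ℓ / 2}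

/-- The open axes-parallel cube with center `c` and side length `ℓ`
(the interior of `cube c ℓ` when `ℓ > 0`). -/
def openCube (c : RN N) (ℓ : ℝ) : Set (RN N) := {y | ∀ i, |y i - c i| < ℓ / 2}

/-- `P` is a (complex) polynomial in `N` variables of degree at most `d`. -/
def IsPolyDegLE (N d : ℕ) (P : RN N → ℂ) : Prop :=
  ∃ c : (Fin N → ℕ) → ℂ, ∀ x : RN N, P x = ∑ α ∈ idxLe N d, c α * ∏ i, ((x i : ℝ) : ℂ) ^ α i

/-- The family `𝓕_L(y,s)` of normalized bump functions supported in `B(y,s)`. -/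
def calF (L : ℕ) (y : RN N) (s : ℝ) : Set (RN N → ℝ) :=
  {ψ | ContDiff ℝ (⊤ : ℕ∞) ψ ∧ HasCompactSupport ψ ∧ tsupport ψ ⊆ ball y s ∧
    ∀ α : Fin N → ℕ, mOrder α ≤ L → ∀ z, |md α ψ z| ≤ (s ^ (N + mOrder α))⁻¹}

open scoped ContDiff

/-- A relation preserved by simultaneous application of two families of maps, with a degree
counter, is preserved by the corresponding iterated compositions. -/
theorem rel_foldr_iterate {X Y : Type*} (R : ℕ → X → Y → Prop) :
    ∀ {n : ℕ} (D : Fin n → X → X) (D' : Fin n → Y → Y)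
      (_ : ∀ i k x y, R k x y → R (k + 1) (D i x) (D' i y)) (α : Fin n → ℕ) (k : ℕ) (x : X) (y : Y),
      R k x y → R (k + ∑ i, α i)
        (((List.ofFn fun i => (D i)^[α i]).foldr (· ∘ ·) id) x)
        (((List.ofFn fun i => (D' i)^[α i]).foldr (· ∘ ·) id) y) := by
  intro n
  induction n with
  | zero => intro D D' _ α k x y h; simpa using h
  | succ n ih =>
    intro D D' hD α k x y h
    have h1 := ih (fun i => D i.succ) (fun i => D' i.succ) (fun i => hD i.succ)
      (fun i => α i.succ) k x y h
    have h2 : ∀ (j k : ℕ) (x : X) (y : Y), R k x y → R (k + j) ((D 0)^[j] x) ((D' 0)^[j] y) := by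
      intro j
      induction j with
      | zero => intro k x y h; simpa using h
      | succ j ihj =>
        intro k x y h
        rw [Function.iterate_succ_apply', Function.iterate_succ_apply', ← add_assoc]
        exact hD 0 _ _ _ (ihj k x y h)
    have h3 := h2 (α 0) _ _ _ h1
    rw [List.ofFn_succ, List.ofFn_succ, List.foldr_cons, List.foldr_cons, Fin.sum_univ_succ]
    rw [Function.comp_apply, Function.comp_apply]
    convert h3 using 1
    ring

theorem foldr_iterate_add_single {X : Type*} (S : X → Prop) :
    ∀ {n : ℕ} (D : Fin n → X → X) (_ : ∀ i x, S x → S (D i x))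
      (_ : ∀ i j x, S x → D i (D j x) = D j (D i x)) (α : Fin n → ℕ) (j : Fin n) (x : X), S x →
      ((List.ofFn fun i => (D i)^[(α + Pi.single j 1 : Fin n → ℕ) i]).foldr (· ∘ ·) id) x =
        ((List.ofFn fun i => (D i)^[α i]).foldr (· ∘ ·) id) (D j x) := by
  intro n
  induction n with
  | zero => intro D _ _ α j; exact j.elim0
  | succ n ih =>
    intro D hS hc α j x hx
    rw [List.ofFn_succ, List.ofFn_succ, List.foldr_cons, List.foldr_cons]
    simp only [Function.comp_apply]
    refine Fin.cases ?_ (fun j => ?_) j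
    · have h := (rel_foldr_iterate (fun _ (x y : X) => S x ∧ S y ∧ y = D 0 x)
        (fun i : Fin n => D i.succ) (fun i : Fin n => D i.succ) (by
          rintro i - x y ⟨hx, hy, rfl⟩
          exact ⟨hS _ _ hx, hS _ _ hy, hc _ _ _ hx⟩) (fun i => α i.succ) 0 x (D 0 x)
          ⟨hx, hS _ _ hx, rfl⟩).2.2
      rw [h, ← Function.iterate_succ_apply]
      simp
    · have h := ih (fun i => D i.succ) (fun i => hS i.succ) (fun i k => hc i.succ k.succ)
        (fun i => α i.succ) j x hx
      rw [← h]
      simp [Pi.single_apply]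

theorem contDiff_pd {g : RN N → ℝ} (hg : ContDiff ℝ ∞ g) (i : Fin N) : ContDiff ℝ ∞ (pd i g) :=
  (hg.fderiv_right (m := ∞) (by simp)).clm_apply contDiff_const

theorem tsupport_pd_subset (g : RN N → ℝ) (i : Fin N) : tsupport (pd i g) ⊆ tsupport g :=
  tsupport_fderiv_apply_subset ℝ _

theorem pd_comm {g : RN N → ℝ} (hg : ContDiff ℝ ∞ g) (i j : Fin N) :
    pd i (pd j g) = pd j (pd i g) := by
  have hd : Differentiable ℝ (fderiv ℝ g) :=
    (hg.fderiv_right (m := ∞) (by simp)).differentiable (by simp)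
  have key : ∀ (i j : Fin N) (x : RN N), pd i (pd j g) x =
      fderiv ℝ (fderiv ℝ g) x (EuclideanSpace.single i 1) (EuclideanSpace.single j 1) := by
    intro i j x
    unfold pd
    rw [fderiv_clm_apply (hd x) (by fun_prop)]
    simp
  ext x
  rw [key, key]
  exact (hg.contDiffAt.isSymmSndFDerivAt (by
    rw [minSmoothness_of_isRCLikeNormedField]; exact ENat.LEInfty.out)) _ _

theorem md_rel {Y : Type*} (R : ℕ → (RN N → ℝ) → Y → Prop) (D : Fin N → Y → Y)
    (hD : ∀ i k g y, R k g y → R (k + 1) (pd i g) (D i y)) (α : Fin N → ℕ) (k : ℕ)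
    (g : RN N → ℝ) (y : Y) (h : R k g y) :
    R (k + mOrder α) (md α g) (((List.ofFn fun i => (D i)^[α i]).foldr (· ∘ ·) id) y) :=
  rel_foldr_iterate R pd D hD α k g y h

theorem tsupport_md_subset (g : RN N → ℝ) (α : Fin N → ℕ) : tsupport (md α g) ⊆ tsupport g :=
  md_rel (fun _ h (_ : Unit) => tsupport h ⊆ tsupport g) (fun _ => id)
    (fun i _ h _ hh => (tsupport_pd_subset h i).trans hh) α 0 g () subset_rfl

theorem md_zero (g : RN N → ℝ) : md 0 g = g := by
  have : ∀ n : ℕ, ∀ h : RN N → ℝ,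
      ((List.replicate n (id : (RN N → ℝ) → RN N → ℝ)).foldr (· ∘ ·) id) h = h := by
    intro n h
    induction n with
    | zero => rfl
    | succ n ih => rw [List.replicate_succ, List.foldr_cons, Function.comp_apply, ih]; rfl
  unfold md
  simp only [Pi.zero_apply, Function.iterate_zero, List.ofFn_const]
  exact this _ _

theorem md_add_single {g : RN N → ℝ} (hg : ContDiff ℝ ∞ g) (β : Fin N → ℕ) (i : Fin N) :
    md (β + Pi.single i 1) g = md β (pd i g) :=
  foldr_iterate_add_single (fun g : RN N → ℝ => ContDiff ℝ ∞ g) pd (fun i _ h => contDiff_pd h i)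
    (fun i j _ h => pd_comm h i j) β i g hg

theorem md_comp_affine {g : RN N → ℝ} (hg : ContDiff ℝ ∞ g) (a b : ℝ) (w : RN N)
    (α : Fin N → ℕ) :
    md α (fun z => a * g (b • z + w)) = fun z => a * b ^ mOrder α * md α g (b • z + w) := by
  have h := (md_rel (fun k g (h : RN N → ℝ) => ContDiff ℝ ∞ h ∧
    g = fun z => a * b ^ k * h (b • z + w)) pd (by
      rintro i k - h ⟨hh, rfl⟩
      refine ⟨contDiff_pd hh i, ?_⟩
      ext z
      have h1 : HasFDerivAt h (fderiv ℝ h (b • z + w)) (b • z + w) :=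
        (hh.differentiable (by simp) _).hasFDerivAt
      have h2 : HasFDerivAt (fun z : RN N => b • z + w) (b • ContinuousLinearMap.id ℝ (RN N)) z :=
        ((hasFDerivAt_id z).const_smul b).add_const w
      have h3 := (h1.comp z h2).const_mul (a * b ^ k)
      have h4 : (fun z => a * b ^ k * h (b • z + w)) =
          fun z => a * b ^ k * (h ∘ fun z => b • z + w) z := rfl
      unfold pd
      rw [h4, h3.fderiv]
      simp
      ring) α 0 (fun z => a * g (b • z + w)) g ⟨hg, by simp⟩).2
  simpa [md] using h

theorem md_sum {ι : Type*} (s : Finset ι) {g : ι → RN N → ℝ} (hg : ∀ a, ContDiff ℝ ∞ (g a))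
    (α : Fin N → ℕ) (v : RN N) :
    md α (fun v => ∑ a ∈ s, g a v) v = ∑ a ∈ s, md α (g a) v := by
  have h := fun a => md_rel (fun _ k (y : ι → RN N → ℝ) => y a = k) (fun i y a => pd i (y a))
    (by rintro i - - y rfl; rfl) α 0 (g a) g rfl
  have h' := (md_rel (fun _ k (y : ι → RN N → ℝ) => (∀ a, ContDiff ℝ ∞ (y a)) ∧
    k = fun v => ∑ a ∈ s, y a v) (fun i y a => pd i (y a)) (by
      rintro i - - y ⟨hy, rfl⟩
      refine ⟨fun a => contDiff_pd (hy a) i, ?_⟩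
      ext v
      unfold pd
      rw [fderiv_fun_sum fun a _ => (hy a).differentiable (by simp) v]
      simp) α 0 _ g ⟨hg, rfl⟩).2
  rw [h']
  exact Finset.sum_congr rfl fun a _ => congrFun (h a) v

/-- The operator `h ↦ div ((v + u) h)`. -/
def divOp (u : RN N) (h : RN N → ℝ) : RN N → ℝ :=
  fun v => ∑ i, pd i (fun v => (v i + u i) * h v) v

/-- The operator `(E + 1) ⋯ (E + k)`, where `E = divOp u`. -/
def iterOp : ℕ → RN N → (RN N → ℝ) → RN N → ℝ
  | 0, _, g => g
  | k + 1, u, g => iterOp k u fun v => divOp u g v + (k + 1 : ℕ) * g v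

/-- The monomial `(v + u) ^ β`. -/
def shiftMonomial (u : RN N) (β : Fin N → ℕ) : RN N → ℝ :=
  fun v => ∏ i, (v i + u i) ^ β i

theorem contDiff_shiftMonomial (u : RN N) (β : Fin N → ℕ) :
    ContDiff ℝ ∞ (shiftMonomial u β) := by
  unfold shiftMonomial
  fun_prop

theorem contDiff_coord_mul {h : RN N → ℝ} (hh : ContDiff ℝ ∞ h) (u : RN N) (i : Fin N) :
    ContDiff ℝ ∞ (fun v : RN N => (v i + u i) * h v) := by
  fun_prop

theorem contDiff_divOp {h : RN N → ℝ} (hh : ContDiff ℝ ∞ h) (u : RN N) :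
    ContDiff ℝ ∞ (divOp u h) :=
  ContDiff.sum fun i _ => contDiff_pd (contDiff_coord_mul hh u i) i

theorem divOp_apply {h : RN N → ℝ} (hh : ContDiff ℝ ∞ h) (u v : RN N) :
    divOp u h v = N * h v + fderiv ℝ h v (v + u) := by
  have hd := hh.differentiable (by simp) v
  have h1 : ∀ i, pd i (fun v : RN N => (v i + u i) * h v) v =
      h v + (v + u) i * fderiv ℝ h v (EuclideanSpace.single i 1) := by
    intro i
    have hc : HasFDerivAt (fun v : RN N => v i + u i) (EuclideanSpace.proj i : RN N →L[ℝ] ℝ) v :=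
      (EuclideanSpace.proj i : RN N →L[ℝ] ℝ).hasFDerivAt.add_const (u i)
    have hm : fderiv ℝ (fun v : RN N => (v i + u i) * h v) v = _ :=
      (hc.mul hd.hasFDerivAt).fderiv
    unfold pd
    rw [hm]
    simp
    ring
  have h2 : v + u = ∑ i, (v + u) i • EuclideanSpace.single i (1 : ℝ) := by
    ext j
    simp [Pi.single_apply]
  unfold divOp
  conv_rhs => rw [h2, map_sum]
  simp_rw [h1, Finset.sum_add_distrib, map_smul]
  simp

theorem fderiv_shiftMonomial (u : RN N) (β : Fin N → ℕ) (v : RN N) :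
    fderiv ℝ (shiftMonomial u β) v (v + u) = mOrder β * shiftMonomial u β v := by
  rw [← ((contDiff_shiftMonomial u β).differentiable (by simp) v).lineDeriv_eq_fderiv]
  have h : ∀ s : ℝ, shiftMonomial u β (v + s • (v + u)) =
      (1 + s) ^ mOrder β * shiftMonomial u β v := by
    intro s
    unfold shiftMonomial mOrder
    rw [← Finset.prod_pow_eq_pow_sum, ← Finset.prod_mul_distrib]
    refine Finset.prod_congr rfl fun i _ => ?_
    rw [← mul_pow]
    simp
    ring
  unfold lineDeriv
  simp_rw [h]
  have h1 : HasDerivAt (fun s : ℝ => (1 + s) ^ mOrder β) (mOrder β * (1 + 0) ^ (mOrder β - 1) * 1)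
      (0 : ℝ) := ((hasDerivAt_id (0 : ℝ)).const_add 1).pow (mOrder β)
  rw [(h1.mul_const _).deriv]
  simp

theorem divOp_shiftMonomial_mul {g : RN N → ℝ} (hg : ContDiff ℝ ∞ g) (u : RN N) (β : Fin N → ℕ)
    (v : RN N) : divOp u (fun v => shiftMonomial u β v * g v) v =
      shiftMonomial u β v * (divOp u g v + mOrder β * g v) := by
  have hm := contDiff_shiftMonomial u β
  have h1 := ((hm.differentiable (by simp) v).hasFDerivAt.mul
    (hg.differentiable (by simp) v).hasFDerivAt).fderiv
  have h2 : fderiv ℝ (fun v => shiftMonomial u β v * g v) v = _ := h1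
  rw [divOp_apply (hm.mul hg), divOp_apply hg, h2]
  simp only [add_apply, smul_apply, smul_eq_mul, fderiv_shiftMonomial]
  ring

theorem mem_idxEq {k : ℕ} {β : Fin N → ℕ} : β ∈ idxEq N k ↔ mOrder β = k := by
  unfold idxEq
  simp only [Finset.mem_filter, Fintype.mem_piFinset, Finset.mem_range, and_iff_right_iff_imp]
  rintro rfl i
  exact Nat.lt_succ_of_le (Finset.single_le_sum (fun _ _ => Nat.zero_le _) (Finset.mem_univ i))

theorem mem_idxLe {k : ℕ} {β : Fin N → ℕ} : β ∈ idxLe N k ↔ mOrder β ≤ k := by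
  unfold idxLe
  simp only [Finset.mem_filter, Fintype.mem_piFinset, Finset.mem_range, and_iff_right_iff_imp]
  exact fun h i => Nat.lt_succ_of_le
    ((Finset.single_le_sum (fun _ _ => Nat.zero_le _) (Finset.mem_univ i)).trans h)

theorem mOrder_add_single (β : Fin N → ℕ) (i : Fin N) :
    mOrder (β + Pi.single i 1) = mOrder β + 1 := by
  simp [mOrder, Finset.sum_add_distrib]

theorem sum_md_divOp_succ (k : ℕ) (c : (Fin N → ℕ) → ℝ) : ∃ c' : (Fin N → ℕ) → ℝ,
    ∀ (u : RN N) (g : RN N → ℝ), ContDiff ℝ ∞ g → ∀ v,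
      ∑ β ∈ idxEq N k, c β * md β (fun v => shiftMonomial u β v * (divOp u g v + k * g v)) v =
      ∑ γ ∈ idxEq N (k + 1), c' γ * md γ (fun v => shiftMonomial u γ v * g v) v := by
  classical
  refine ⟨fun γ => ∑ q ∈ (idxEq N k ×ˢ Finset.univ) with q.1 + Pi.single q.2 1 = γ, c q.1,
    fun u g hg v => ?_⟩
  have h1 : ∀ β ∈ idxEq N k,
      c β * md β (fun v => shiftMonomial u β v * (divOp u g v + k * g v)) v =
      ∑ i, c β * md (β + Pi.single i 1)
        (fun v => shiftMonomial u (β + Pi.single i 1) v * g v) v := by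
    intro β hβ
    rw [mem_idxEq] at hβ
    have hmg := (contDiff_shiftMonomial u β).mul hg
    rw [← Finset.mul_sum]
    congr 1
    have e1 : (fun v => shiftMonomial u β v * (divOp u g v + k * g v)) =
        fun v => ∑ i, pd i (fun v => (v i + u i) * (shiftMonomial u β v * g v)) v := by
      ext v
      rw [← hβ, ← divOp_shiftMonomial_mul hg]
      rfl
    rw [e1, md_sum _ fun i => contDiff_pd (contDiff_coord_mul hmg u i) i]
    refine Finset.sum_congr rfl fun i _ => ?_
    rw [md_add_single ((contDiff_shiftMonomial u _).mul hg)]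
    congr 2
    ext v
    rw [← mul_assoc]
    congr 1
    unfold shiftMonomial
    simp only [Pi.add_apply, pow_add, Finset.prod_mul_distrib]
    rw [mul_comm]
    congr 1
    rw [Finset.prod_eq_single i] <;> simp +contextual
  rw [Finset.sum_congr rfl h1, ← Finset.sum_product', ← Finset.sum_fiberwise_of_maps_to
    (t := idxEq N (k + 1)) (g := fun q : (Fin N → ℕ) × Fin N => q.1 + Pi.single q.2 1)]
  · refine Finset.sum_congr rfl fun γ _ => ?_
    rw [Finset.sum_mul]
    refine Finset.sum_congr rfl fun q hq => ?_
    rw [(Finset.mem_filter.1 hq).2]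
  · intro q hq
    rw [Finset.mem_product, mem_idxEq] at hq
    rw [mem_idxEq, mOrder_add_single, hq.1]

theorem divOp_iterOp (k : ℕ) : ∃ c : (Fin N → ℕ) → ℝ, ∀ (u : RN N) (g : RN N → ℝ),
    ContDiff ℝ ∞ g → ∀ v, divOp u (iterOp k u g) v =
      ∑ β ∈ idxEq N (k + 1), c β * md β (fun v => shiftMonomial u β v * g v) v := by
  induction k with
  | zero =>
    obtain ⟨c, hc⟩ := sum_md_divOp_succ (N := N) 0 fun _ => 1
    refine ⟨c, fun u g hg v => ?_⟩
    rw [← hc u g hg v, Finset.sum_eq_single 0]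
    · simp [md_zero, shiftMonomial, iterOp]
    · intro β hβ hne
      rw [mem_idxEq] at hβ
      refine absurd (funext fun i => ?_) hne
      exact Finset.sum_eq_zero_iff.1 hβ i (Finset.mem_univ i)
    · intro h
      exact absurd (mem_idxEq.2 (by simp [mOrder])) h
  | succ k ih =>
    obtain ⟨c, hc⟩ := ih
    obtain ⟨c', hc'⟩ := sum_md_divOp_succ (N := N) (k + 1) c
    refine ⟨c', fun u g hg v => ?_⟩
    rw [← hc' u g hg v]
    exact hc u _ ((contDiff_divOp hg u).add (contDiff_const.mul hg)) v

/-- Finite sums of products `q(u) h(v)`, where `q` is a polynomial of degree at most `d` and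
`h` is smooth and supported in the closed ball of radius `1 / 2`. -/
inductive PolyFam : ℕ → (RN N → RN N → ℝ) → Prop
  | base {d : ℕ} (q : MvPolynomial (Fin N) ℝ) (h : RN N → ℝ) (hq : q.totalDegree ≤ d)
      (hh : ContDiff ℝ ∞ h) (hs : tsupport h ⊆ closedBall 0 (1 / 2)) :
      PolyFam d fun u v => MvPolynomial.eval (fun i => u i) q * h v
  | add {d : ℕ} {K K' : RN N → RN N → ℝ} (hK : PolyFam d K) (hK' : PolyFam d K') :
      PolyFam d fun u v => K u v + K' u v

namespace PolyFam

variable {d : ℕ} {K : RN N → RN N → ℝ}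

theorem contDiff (hK : PolyFam d K) (u : RN N) : ContDiff ℝ ∞ (K u) := by
  induction hK with
  | base q h hq hh hs => exact contDiff_const.mul hh
  | add _ _ h1 h2 => exact h1.add h2

theorem tsupport_subset (hK : PolyFam d K) (u : RN N) : tsupport (K u) ⊆ closedBall 0 (1 / 2) := by
  induction hK with
  | base q h hq hh hs => exact (tsupport_mul_subset_right (f := fun _ => _)).trans hs
  | add _ _ h1 h2 => exact (tsupport_add _ _).trans (union_subset h1 h2)

theorem const {g : RN N → ℝ} (hg : ContDiff ℝ ∞ g) (hs : tsupport g ⊆ closedBall 0 (1 / 2)) :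
    PolyFam 0 fun _ : RN N => g := by
  simpa using base 1 g (d := 0) (by simp) hg hs

theorem poly_mul (hK : PolyFam d K) {e : ℕ} (p : MvPolynomial (Fin N) ℝ) (hp : p.totalDegree ≤ e) :
    PolyFam (d + e) fun u v => MvPolynomial.eval (fun i => u i) p * K u v := by
  induction hK with
  | base q h hq hh hs =>
    simpa [mul_assoc, mul_left_comm] using
      base (q * p) h ((MvPolynomial.totalDegree_mul _ _).trans (add_le_add hq hp)) hh hs
  | add _ _ h1 h2 => simpa [mul_add] using h1.add h2

theorem mono (hK : PolyFam d K) {e : ℕ} (h : d ≤ e) : PolyFam e K := by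
  obtain ⟨j, rfl⟩ := Nat.exists_eq_add_of_le h
  simpa using hK.poly_mul (e := j) 1 (by simp)

theorem const_mul (hK : PolyFam d K) (a : ℝ) : PolyFam d fun u v => a * K u v := by
  simpa using hK.poly_mul (e := 0) (MvPolynomial.C a) (by simp)

theorem fun_mul (hK : PolyFam d K) {g : RN N → ℝ} (hg : ContDiff ℝ ∞ g) :
    PolyFam d fun u v => g v * K u v := by
  induction hK with
  | base q h hq hh hs =>
    simpa [mul_left_comm] using
      base q (fun v => g v * h v) hq (hg.mul hh) ((tsupport_mul_subset_right (f := g)).trans hs)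
  | add _ _ h1 h2 => simpa [mul_add] using h1.add h2

theorem coord_mul (hK : PolyFam d K) (i : Fin N) :
    PolyFam (d + 1) fun u v => (v i + u i) * K u v := by
  have h1 := (hK.fun_mul (g := fun v => v i) (by fun_prop)).mono (Nat.le_succ d)
  have h2 := hK.poly_mul (e := 1) (MvPolynomial.X i) (by simp)
  simpa [add_mul] using h1.add h2

theorem pd (hK : PolyFam d K) (i : Fin N) : PolyFam d fun u => _root_.pd i (K u) := by
  induction hK with
  | base q h hq hh hs =>
    convert base q (_root_.pd i h) hq (contDiff_pd hh i) ((tsupport_pd_subset h i).trans hs)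
      using 3 with u v
    unfold _root_.pd
    rw [fderiv_const_mul (hh.differentiable (by simp) v)]
    rfl
  | add hK hK' h1 h2 =>
    convert h1.add h2 using 3 with u v
    unfold _root_.pd
    rw [fderiv_fun_add ((hK.contDiff u).differentiable (by simp) v)
      ((hK'.contDiff u).differentiable (by simp) v)]
    rfl

theorem md (hK : PolyFam d K) (α : Fin N → ℕ) : PolyFam d fun u => _root_.md α (K u) := by
  have h := (md_rel (fun _ (_ : RN N → ℝ) (y : RN N → RN N → ℝ) => PolyFam d y)
    (fun i y u => _root_.pd i (y u)) (fun i _ _ y hy => hy.pd i) α 0 0 K hK)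
  convert h using 2 with u
  exact (md_rel (fun _ k (y : RN N → RN N → ℝ) => y u = k) (fun i y u => _root_.pd i (y u))
    (by rintro i - - y rfl; rfl) α 0 (K u) K rfl).symm

theorem sum {ι : Type*} (s : Finset ι) {F : ι → RN N → RN N → ℝ} (hF : ∀ a, PolyFam d (F a)) :
    PolyFam d fun u v => ∑ a ∈ s, F a u v := by
  classical
  induction s using Finset.induction_on with
  | empty => simpa using base (d := d) (0 : MvPolynomial (Fin N) ℝ) 0 (by simp) contDiff_const (by
      rw [tsupport_eq_empty_iff.2 rfl]; exact empty_subset _)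
  | insert a s ha ih => simpa [Finset.sum_insert ha] using (hF a).add ih

theorem divOp (hK : PolyFam d K) : PolyFam (d + 1) fun u => _root_.divOp u (K u) :=
  sum Finset.univ fun i => (hK.coord_mul i).pd i

theorem iterOp (k : ℕ) : ∀ {d : ℕ} {K : RN N → RN N → ℝ}, PolyFam d K →
    PolyFam (d + k) fun u => _root_.iterOp k u (K u) := by
  induction k with
  | zero => exact fun hK => hK
  | succ k ih =>
    intro d K hK
    have h := ih (hK.divOp.add ((hK.const_mul (k + 1 : ℕ)).mono (Nat.le_succ d)))
    rwa [add_assoc, add_comm 1 k] at h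

theorem shiftMonomial_mul (hK : PolyFam d K) (β : Fin N → ℕ) :
    ∃ e, PolyFam e fun u v => shiftMonomial u β v * K u v := by
  classical
  have key : ∀ s : Finset (Fin N),
      ∃ e, PolyFam e fun u v => (∏ i ∈ s, (v i + u i) ^ β i) * K u v := by
    intro s
    induction s using Finset.induction_on with
    | empty => exact ⟨d, by simpa using hK⟩
    | insert i s hi ih =>
      obtain ⟨e, he⟩ := ih
      have hpow : ∀ n : ℕ, PolyFam (e + n)
          fun u v => (v i + u i) ^ n * ((∏ i ∈ s, (v i + u i) ^ β i) * K u v) := by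
        intro n
        induction n with
        | zero => simpa using he
        | succ n ihn =>
          have h := ihn.coord_mul i
          rw [add_assoc] at h
          simpa [pow_succ', mul_assoc] using h
      exact ⟨_, by simpa [Finset.prod_insert hi, mul_assoc] using hpow (β i)⟩
  exact key Finset.univ

theorem exists_bound (hK : PolyFam d K) : ∃ M : ℝ, ∀ u : RN N, ‖u‖ ≤ 1 → ∀ v, |K u v| ≤ M := by
  induction hK with
  | base q h hq hh hs =>
    have hc : HasCompactSupport h :=
      (isCompact_closedBall (0 : RN N) (1 / 2)).of_isClosed_subset (isClosed_tsupport h) hs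
    obtain ⟨A, hA⟩ := hc.exists_bound_of_continuous hh.continuous
    have hq' : Continuous fun u : RN N => MvPolynomial.eval (fun i => u i) q :=
      (MvPolynomial.continuous_eval q).comp (by fun_prop)
    obtain ⟨B, hB⟩ := (isCompact_closedBall (0 : RN N) 1).exists_bound_of_continuousOn
      hq'.continuousOn
    refine ⟨B * A, fun u hu v => ?_⟩
    rw [abs_mul]
    have := hB u (by simpa using hu)
    exact mul_le_mul this (hA v) (abs_nonneg _) ((norm_nonneg _).trans this)
  | add _ _ h1 h2 =>
    obtain ⟨A, hA⟩ := h1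
    obtain ⟨B, hB⟩ := h2
    exact ⟨A + B, fun u hu v => (abs_add_le _ _).trans (add_le_add (hA u hu v) (hB u hu v))⟩

theorem hasCompactSupport (hK : PolyFam d K) (u : RN N) : HasCompactSupport (K u) :=
  (isCompact_closedBall (0 : RN N) (1 / 2)).of_isClosed_subset (isClosed_tsupport _)
    (hK.tsupport_subset u)

/-- Integrating a family with polynomial dependence on the parameter against a fixed function
gives a polynomial in the parameter. -/
theorem exists_integral_eq (hK : PolyFam d K) {f : RN N → ℂ} (hf : LocallyIntegrable f volume)
    (x : RN N) {t : ℝ} (ht : t ≠ 0) : ∃ q : MvPolynomial (Fin N) ℂ, q.totalDegree ≤ d ∧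
      ∀ u : RN N, ∫ z, K u (t⁻¹ • (z - x)) • f z = MvPolynomial.eval (fun i => (u i : ℂ)) q := by
  let e : RN N ≃ₜ RN N :=
    (Homeomorph.addRight (-x)).trans (Homeomorph.smulOfNeZero t⁻¹ (inv_ne_zero ht))
  have hint : ∀ {h : RN N → ℝ}, ContDiff ℝ ∞ h → HasCompactSupport h →
      Integrable fun z => h (t⁻¹ • (z - x)) • f z := by
    intro h hh hc
    refine hf.integrable_smul_left_of_hasCompactSupport (hh.continuous.comp (by fun_prop)) ?_
    have he : (fun z => h (t⁻¹ • (z - x))) = h ∘ e := by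
      ext z
      simp [e, sub_eq_add_neg]
    rw [he]
    exact hc.comp_homeomorph e
  induction hK with
  | base q h hq hh hs =>
    refine ⟨MvPolynomial.C (∫ z, h (t⁻¹ • (z - x)) • f z) * MvPolynomial.map Complex.ofRealHom q,
      (MvPolynomial.totalDegree_mul _ _).trans ?_, fun u => ?_⟩
    · rw [MvPolynomial.totalDegree_C, zero_add]
      exact (Finset.sup_mono (MvPolynomial.support_map_subset _ _)).trans hq
    · simp_rw [mul_smul, integral_smul]
      rw [map_mul, MvPolynomial.eval_C, MvPolynomial.eval_map, mul_comm, Complex.real_smul]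
      congr 1
      exact MvPolynomial.eval₂_comp_left Complex.ofRealHom (RingHom.id ℝ) (fun i => u i) q
  | add hK hK' h1 h2 =>
    obtain ⟨q1, hq1, h1⟩ := h1
    obtain ⟨q2, hq2, h2⟩ := h2
    refine ⟨q1 + q2, (MvPolynomial.totalDegree_add _ _).trans (max_le hq1 hq2), fun u => ?_⟩
    rw [map_add, ← h1, ← h2, ← integral_add (hint (hK.contDiff u) (hK.hasCompactSupport u))
      (hint (hK'.contDiff u) (hK'.hasCompactSupport u))]
    simp_rw [add_smul]

end PolyFam

theorem isPolyDegLE_eval {d : ℕ} (q : MvPolynomial (Fin N) ℂ) (hq : q.totalDegree ≤ d) :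
    IsPolyDegLE N d fun y => MvPolynomial.eval (fun i => (y i : ℂ)) q := by
  refine ⟨fun α => q.coeff (Finsupp.equivFunOnFinite.symm α), fun y => ?_⟩
  dsimp only
  rw [MvPolynomial.eval_eq']
  symm
  refine Finset.sum_bij_ne_zero (fun α _ _ => Finsupp.equivFunOnFinite.symm α) ?_ ?_ ?_ ?_
  · intro α _ hα
    exact MvPolynomial.mem_support_iff.2 (left_ne_zero_of_mul hα)
  · intro α _ _ β _ _ h
    exact Finsupp.equivFunOnFinite.symm.injective h
  · intro b hb _
    have : Finsupp.equivFunOnFinite.symm (⇑b) = b := Finsupp.equivFunOnFinite.symm_apply_apply b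
    refine ⟨b, mem_idxLe.2 ?_, ?_, this⟩
    · refine le_trans (le_of_eq ?_) ((MvPolynomial.le_totalDegree hb).trans hq)
      rw [Finsupp.sum_fintype _ _ (by simp)]
      rfl
    · rwa [this]
  · intro α _ _
    rfl

/-- The kernel `z ↦ ρ⁻ᴺ h((z - y) / ρ - u)`. -/
def kern (y u : RN N) (ρ : ℝ) (h : RN N → ℝ) (z : RN N) : ℝ :=
  (ρ ^ N)⁻¹ * h (ρ⁻¹ • (z - y) - u)

theorem contDiff_kern {h : RN N → ℝ} (hh : ContDiff ℝ ∞ h) (y u : RN N) (ρ : ℝ) :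
    ContDiff ℝ ∞ (kern y u ρ h) := by
  unfold kern
  fun_prop

theorem support_kern_subset {h : RN N → ℝ} {ρ : ℝ} (hρ : 0 < ρ)
    (hs : tsupport h ⊆ closedBall 0 (1 / 2)) (y u : RN N) :
    Function.support (kern y u ρ h) ⊆ closedBall (y + ρ • u) (ρ / 2) := by
  intro z hz
  have h1 : ρ⁻¹ • (z - y) - u ∈ closedBall (0 : RN N) (1 / 2) :=
    hs (subset_tsupport h (right_ne_zero_of_mul hz))
  rw [mem_closedBall_zero_iff] at h1
  rw [mem_closedBall_iff_norm]
  have h2 : z - (y + ρ • u) = ρ • (ρ⁻¹ • (z - y) - u) := by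
    rw [smul_sub, smul_inv_smul₀ hρ.ne']
    abel
  rw [h2, norm_smul, Real.norm_of_nonneg hρ.le]
  nlinarith

theorem tsupport_kern_subset {h : RN N → ℝ} {ρ : ℝ} (hρ : 0 < ρ)
    (hs : tsupport h ⊆ closedBall 0 (1 / 2)) (y u : RN N) :
    tsupport (kern y u ρ h) ⊆ closedBall (y + ρ • u) (ρ / 2) :=
  closure_minimal (support_kern_subset hρ hs y u) isClosed_closedBall

theorem closedBall_add_smul_subset {y u : RN N} (hu : ‖u‖ ≤ 1) {ρ : ℝ} (hρ : 0 < ρ) :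
    closedBall (y + ρ • u) (ρ / 2) ⊆ closedBall y (3 / 2 * ρ) := by
  refine closedBall_subset_closedBall' ?_
  rw [dist_eq_norm, add_sub_cancel_left, norm_smul, Real.norm_of_nonneg hρ.le]
  nlinarith

theorem hasCompactSupport_kern {h : RN N → ℝ} {ρ : ℝ} (hρ : 0 < ρ)
    (hs : tsupport h ⊆ closedBall 0 (1 / 2)) (y u : RN N) :
    HasCompactSupport (kern y u ρ h) :=
  (isCompact_closedBall (y + ρ • u) (ρ / 2)).of_isClosed_subset (isClosed_tsupport _)
    (tsupport_kern_subset hρ hs y u)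

theorem md_kern {h : RN N → ℝ} (hh : ContDiff ℝ ∞ h) (y u : RN N) (ρ : ℝ) (α : Fin N → ℕ) :
    md α (kern y u ρ h) = fun z => (ρ ^ mOrder α)⁻¹ * kern y u ρ (md α h) z := by
  have e : ∀ z, ρ⁻¹ • (z - y) - u = ρ⁻¹ • z + (-(ρ⁻¹ • y) - u) := by
    intro z
    rw [smul_sub]
    abel
  unfold kern
  simp_rw [e]
  rw [md_comp_affine hh]
  ext z
  rw [inv_pow]
  ring

theorem integral_kern (h : RN N → ℝ) (y u : RN N) {ρ : ℝ} (hρ : 0 < ρ) :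
    ∫ z, kern y u ρ h z = ∫ v, h v := by
  have e : ∀ z, ρ⁻¹ • (z - y) - u = ρ⁻¹ • (z - (y + ρ • u)) := by
    intro z
    rw [smul_sub, smul_sub, smul_add, inv_smul_smul₀ hρ.ne']
    abel
  unfold kern
  simp_rw [e]
  rw [integral_const_mul, integral_sub_right_eq_self (fun z => h (ρ⁻¹ • z)),
    Measure.integral_comp_inv_smul_of_nonneg _ _ hρ.le]
  simp only [finrank_euclideanSpace, Fintype.card_fin, smul_eq_mul]
  rw [inv_mul_cancel_left₀ (by positivity)]

theorem hasDerivAt_kern {h : RN N → ℝ} (hh : ContDiff ℝ ∞ h) (y u z : RN N) {ρ : ℝ}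
    (hρ : ρ ≠ 0) :
    HasDerivAt (fun ρ => kern y u ρ h z) (-ρ⁻¹ * kern y u ρ (divOp u h) z) ρ := by
  have h1 : HasDerivAt (fun ρ : ℝ => ρ⁻¹ • (z - y) - u) (-(ρ ^ 2)⁻¹ • (z - y)) ρ :=
    ((hasDerivAt_inv hρ).smul_const (z - y)).sub_const u
  have h2 := (hh.differentiable (by simp) (ρ⁻¹ • (z - y) - u)).hasFDerivAt.comp_hasDerivAt ρ h1
  have h3 : HasDerivAt (fun ρ : ℝ => (ρ ^ N)⁻¹) _ ρ := (hasDerivAt_pow N ρ).inv (pow_ne_zero N hρ)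
  have h4 : HasDerivAt (fun ρ => kern y u ρ h z) _ ρ := h3.mul h2
  convert h4 using 1
  unfold kern
  rw [divOp_apply hh, sub_add_cancel, map_smul, map_smul]
  simp only [smul_eq_mul]
  rcases N with _ | n
  · simp
    field_simp
  · simp only [Nat.add_sub_cancel]
    field_simp
    ring

theorem integral_divOp {h : RN N → ℝ} (hh : ContDiff ℝ ∞ h) (hc : HasCompactSupport h)
    (u : RN N) : ∫ v, divOp u h v = 0 := by
  have hci : ∀ i, HasCompactSupport fun v : RN N => (v i + u i) * h v := fun i => hc.mul_left
  have hpi : ∀ i : Fin N, Integrable (pd i fun v : RN N => (v i + u i) * h v) := fun i =>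
    (contDiff_pd (contDiff_coord_mul hh u i) i).continuous.integrable_of_hasCompactSupport
      ((hci i).of_isClosed_subset (isClosed_tsupport _) (tsupport_pd_subset _ i))
  unfold divOp
  rw [integral_finsetSum _ fun i _ => hpi i]
  refine Finset.sum_eq_zero fun i _ => ?_
  have h1 := contDiff_coord_mul hh u i
  have h2 := integral_mul_fderiv_eq_neg_fderiv_mul_of_integrable (μ := (volume : Measure (RN N)))
    (v := EuclideanSpace.single i 1) (f := fun _ => (1 : ℝ))
    (g := fun v : RN N => (v i + u i) * h v) (by simp)
    (by simp only [one_mul]; exact hpi i)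
    (by simpa using h1.continuous.integrable_of_hasCompactSupport (hci i)) (by simp)
    (fun x _ => h1.differentiable (by simp) x)
  simpa [pd] using h2

theorem integral_iterOp (k : ℕ) : ∀ {d : ℕ} {K : RN N → RN N → ℝ}, PolyFam d K → ∀ u,
    ∫ v, iterOp k u (K u) v = k.factorial * ∫ v, K u v := by
  induction k with
  | zero => intro d K _ u; simp [iterOp]
  | succ k ih =>
    intro d K hK u
    have h := ih (hK.divOp.add ((hK.const_mul (k + 1 : ℕ)).mono (Nat.le_succ d))) u
    rw [iterOp, h, integral_add
      ((hK.divOp.contDiff u).continuous.integrable_of_hasCompactSupport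
        (hK.divOp.hasCompactSupport u))
      (((hK.contDiff u).continuous.integrable_of_hasCompactSupport
        (hK.hasCompactSupport u)).const_mul _),
      integral_divOp (hK.contDiff u) (hK.hasCompactSupport u), integral_const_mul,
      Nat.factorial_succ]
    push_cast
    ring

theorem totalDegree_bind₁_le {σ τ R : Type*} [CommSemiring R] (l : σ → MvPolynomial τ R)
    (hl : ∀ i, (l i).totalDegree ≤ 1) (q : MvPolynomial σ R) :
    (MvPolynomial.bind₁ l q).totalDegree ≤ q.totalDegree := by
  rw [MvPolynomial.bind₁, MvPolynomial.aeval_def, MvPolynomial.eval₂_eq]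
  refine MvPolynomial.totalDegree_finsetSum_le fun b hb => ?_
  refine (MvPolynomial.totalDegree_mul _ _).trans ?_
  rw [MvPolynomial.algebraMap_eq, MvPolynomial.totalDegree_C, zero_add]
  refine (MvPolynomial.totalDegree_finsetProd _ _).trans
    (le_trans (Finset.sum_le_sum fun i _ => ?_) (MvPolynomial.le_totalDegree hb))
  exact (MvPolynomial.totalDegree_pow _ _).trans
    ((Nat.mul_le_mul_left _ (hl i)).trans (mul_one _).le)

theorem PolyFam.isPolyDegLE_integral_kern {d : ℕ} {K : RN N → RN N → ℝ} (hK : PolyFam d K)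
    {f : RN N → ℂ} (hf : LocallyIntegrable f volume) (x : RN N) {t : ℝ} (ht : t ≠ 0) :
    IsPolyDegLE N d fun y =>
      ∫ z, kern y (t⁻¹ • (x - y)) t (K (t⁻¹ • (x - y))) z • f z := by
  obtain ⟨q, hq, h⟩ := hK.exists_integral_eq hf x ht
  let l : Fin N → MvPolynomial (Fin N) ℂ := fun i =>
    MvPolynomial.C (t⁻¹ : ℂ) * (MvPolynomial.C (x i : ℂ) - MvPolynomial.X i)
  have hl : ∀ i, (l i).totalDegree ≤ 1 := by
    intro i
    refine (MvPolynomial.totalDegree_mul _ _).trans ?_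
    rw [MvPolynomial.totalDegree_C, zero_add]
    refine (MvPolynomial.totalDegree_sub _ _).trans (max_le (by simp) (by simp))
  convert isPolyDegLE_eval (MvPolynomial.C (((t ^ N)⁻¹ : ℝ) : ℂ) * MvPolynomial.bind₁ l q)
    (d := d) ?_ using 2 with y
  · have e : ∀ z, t⁻¹ • (z - y) - t⁻¹ • (x - y) = t⁻¹ • (z - x) := by
      intro z
      rw [← smul_sub]
      congr 1
      abel
    unfold kern
    simp_rw [e, mul_smul, integral_smul]
    rw [h, map_mul, MvPolynomial.eval_C, Complex.real_smul]
    congr 1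
    have e2 : (fun i => (((t⁻¹ • (x - y)) i : ℝ) : ℂ)) =
        fun i => MvPolynomial.eval (fun i => (y i : ℂ)) (l i) := by
      ext i
      simp [l]
    rw [e2, ← MvPolynomial.coe_aeval_eq_eval, ← MvPolynomial.coe_aeval_eq_eval]
    exact (MvPolynomial.aeval_bind₁ _ _ _).symm
  · refine (MvPolynomial.totalDegree_mul _ _).trans ?_
    rw [MvPolynomial.totalDegree_C, zero_add]
    exact (totalDegree_bind₁_le l hl q).trans hq

theorem hasDerivAt_integral_kern {h : RN N → ℝ} (hh : ContDiff ℝ ∞ h)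
    (hs : tsupport h ⊆ closedBall 0 (1 / 2)) {f : RN N → ℂ} (hf : LocallyIntegrable f volume)
    (y : RN N) {u : RN N} (hu : ‖u‖ ≤ 1) {ρ : ℝ} (hρ : 0 < ρ) :
    HasDerivAt (fun ρ => ∫ z, kern y u ρ h z • f z)
      (∫ z, (-ρ⁻¹ * kern y u ρ (divOp u h) z) • f z) ρ := by
  have hE := contDiff_divOp hh u
  have hEs : tsupport (divOp u h) ⊆ closedBall 0 (1 / 2) :=
    (PolyFam.const hh hs).divOp.tsupport_subset u
  have hc : HasCompactSupport (divOp u h) :=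
    (isCompact_closedBall (0 : RN N) (1 / 2)).of_isClosed_subset (isClosed_tsupport _) hEs
  obtain ⟨A, hA⟩ := hc.exists_bound_of_continuous hE.continuous
  have hA0 : 0 ≤ A := (norm_nonneg _).trans (hA 0)
  refine (hasDerivAt_integral_of_dominated_loc_of_deriv_le (μ := volume)
    (s := Ioo (ρ / 2) (2 * ρ)) (F := fun ρ z => kern y u ρ h z • f z)
    (F' := fun ρ z => (-ρ⁻¹ * kern y u ρ (divOp u h) z) • f z)
    (bound := (closedBall y (3 * ρ)).indicator
      fun z => ((ρ / 2)⁻¹ * (((ρ / 2) ^ N)⁻¹ * A)) * ‖f z‖)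
    (Ioo_mem_nhds (by linarith) (by linarith)) ?_ ?_ ?_ ?_ ?_ ?_).2
  · refine Eventually.of_forall fun r => ?_
    exact (contDiff_kern hh y u r).continuous.aestronglyMeasurable.smul hf.aestronglyMeasurable
  · exact hf.integrable_smul_left_of_hasCompactSupport (contDiff_kern hh y u ρ).continuous
      (hasCompactSupport_kern hρ hs y u)
  · exact ((contDiff_kern hE y u ρ).continuous.const_mul _).aestronglyMeasurable.smul
      hf.aestronglyMeasurable
  · refine Eventually.of_forall fun z r hr => ?_
    have hr0 : 0 < r := by linarith [hr.1]
    by_cases hz : kern y u r (divOp u h) z = 0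
    · rw [hz]
      simp only [mul_zero, zero_smul, norm_zero]
      exact indicator_nonneg (fun z _ => by positivity) z
    · have hz' : z ∈ closedBall y (3 * ρ) := closedBall_subset_closedBall (by linarith [hr.2])
        (closedBall_add_smul_subset hu hr0 (support_kern_subset hr0 hEs y u hz))
      rw [indicator_of_mem hz', norm_smul, norm_mul, norm_neg, norm_inv, Real.norm_of_nonneg hr0.le]
      unfold kern
      rw [norm_mul, norm_inv, norm_pow, Real.norm_of_nonneg hr0.le]
      have := hr.1.le
      gcongr
      exact hA _
  · rw [integrable_indicator_iff measurableSet_closedBall]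
    exact ((hf.integrableOn_isCompact (isCompact_closedBall _ _)).norm).const_mul _
  · refine Eventually.of_forall fun z r hr => ?_
    exact (hasDerivAt_kern hh y u z (by linarith [hr.1] : (0 : ℝ) < r).ne').smul_const _

theorem ae_tendsto_integral_kern {f : RN N → ℂ} (hf : LocallyIntegrable f volume) :
    ∀ᵐ y, ∀ (h : RN N → ℝ) (u : RN N), ContDiff ℝ ∞ h → tsupport h ⊆ closedBall 0 (1 / 2) →
      ∫ v, h v = 1 → ‖u‖ ≤ 1 →
      Tendsto (fun ρ => ∫ z, kern y u ρ h z • f z) (𝓝[>] 0) (𝓝 (f y)) := by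
  filter_upwards [(Besicovitch.vitaliFamily volume).ae_tendsto_average_norm_sub hf] with
    y hy h u hh hs hint hu
  have hc : HasCompactSupport h :=
    (isCompact_closedBall (0 : RN N) (1 / 2)).of_isClosed_subset (isClosed_tsupport _) hs
  obtain ⟨A, hA⟩ := hc.exists_bound_of_continuous hh.continuous
  have hlim : Tendsto (fun ρ : ℝ => 3 / 2 * ρ) (𝓝[>] 0) (𝓝[>] 0) := by
    refine tendsto_nhdsWithin_iff.2 ⟨?_, ?_⟩
    · exact ((continuous_const_mul (3 / 2 : ℝ)).tendsto' 0 0 (by simp)).mono_left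
        nhdsWithin_le_nhds
    · filter_upwards [self_mem_nhdsWithin] with ρ hρ
      have : 0 < ρ := hρ
      exact mem_Ioi.2 (by positivity)
  have hav := (hy.comp (Besicovitch.tendsto_filterAt volume y)).comp hlim
  refine tendsto_integral_smul_of_tendsto_average_norm_sub
    (A * ((3 / 2) ^ N * volume.real (ball (0 : RN N) 1))) hav ?_ ?_ ?_ ?_
  · exact Eventually.of_forall fun ρ => hf.integrableOn_isCompact (isCompact_closedBall _ _)
  · refine tendsto_const_nhds.congr' ?_
    filter_upwards [self_mem_nhdsWithin] with ρ hρ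
    rw [integral_kern h y u hρ, hint]
  · filter_upwards [self_mem_nhdsWithin] with ρ hρ
    exact (support_kern_subset hρ hs y u).trans (closedBall_add_smul_subset hu hρ)
  · filter_upwards [self_mem_nhdsWithin] with ρ hρ z
    have hρ' : 0 < ρ := hρ
    have hv : 0 < volume.real (ball (0 : RN N) 1) :=
      ENNReal.toReal_pos (measure_ball_pos volume _ one_pos).ne' measure_ball_lt_top.ne
    rw [Measure.addHaar_real_closedBall _ _ (by positivity)]
    simp only [finrank_euclideanSpace, Fintype.card_fin]
    have e : A * ((3 / 2) ^ N * volume.real (ball (0 : RN N) 1)) /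
        ((3 / 2 * ρ) ^ N * volume.real (ball (0 : RN N) 1)) = (ρ ^ N)⁻¹ * A := by
      rw [mul_pow]
      field_simp
    rw [e]
    unfold kern
    rw [abs_mul, abs_of_pos (by positivity : 0 < (ρ ^ N)⁻¹)]
    gcongr
    exact hA _

theorem PolyFam.exists_kern_mem_calF {d : ℕ} {K : RN N → RN N → ℝ} (hK : PolyFam d K) (L : ℕ) :
    ∃ A : ℝ, 0 < A ∧ ∀ (y u : RN N) (ρ : ℝ), ‖u‖ ≤ 1 → 0 < ρ →
      kern y u ρ (fun v => A⁻¹ * K u v) ∈ calF L y (7 / 4 * ρ) := by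
  choose M hM using fun α : Fin N → ℕ => (hK.md α).exists_bound
  let B : ℝ := 1 + ∑ α ∈ idxLe N L, |M α|
  have hB : 1 ≤ B := le_add_of_nonneg_right (Finset.sum_nonneg fun _ _ => abs_nonneg _)
  have hMB : ∀ α, mOrder α ≤ L → M α ≤ B := fun α hα =>
    ((le_abs_self _).trans (Finset.single_le_sum (f := fun α => |M α|) (fun _ _ => abs_nonneg _)
      (mem_idxLe.2 hα))).trans (le_add_of_nonneg_left zero_le_one)
  refine ⟨B * (7 / 4) ^ (N + L), by positivity, fun y u ρ hu hρ => ?_⟩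
  set A : ℝ := B * (7 / 4) ^ (N + L) with hA
  have hA0 : 0 < A := by positivity
  have hKA := hK.const_mul A⁻¹
  have hs := hKA.tsupport_subset u
  refine ⟨contDiff_kern (hKA.contDiff u) y u ρ, hasCompactSupport_kern hρ hs y u, ?_, ?_⟩
  · refine ((tsupport_kern_subset hρ hs y u).trans (closedBall_add_smul_subset hu hρ)).trans
      (closedBall_subset_ball (by linarith))
  · intro α hα z
    have e : _root_.md α (fun v => A⁻¹ * K u v) = fun v => A⁻¹ * _root_.md α (K u) v := by
      simpa using md_comp_affine (hK.contDiff u) A⁻¹ 1 0 α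
    rw [md_kern (hKA.contDiff u), e]
    unfold kern
    simp only [abs_mul, abs_inv, abs_pow, abs_of_pos hρ, abs_of_pos hA0]
    have h1 : |_root_.md α (K u) (ρ⁻¹ • (z - y) - u)| ≤ B := (hM α u hu _).trans (hMB α hα)
    have h2 : A⁻¹ * B ≤ ((7 / 4) ^ (N + mOrder α))⁻¹ := by
      have h3 : ((7 / 4 : ℝ) ^ (N + L))⁻¹ ≤ ((7 / 4) ^ (N + mOrder α))⁻¹ := by
        gcongr
        norm_num
      refine le_trans (le_of_eq ?_) h3
      rw [hA]
      field_simp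
    calc (ρ ^ mOrder α)⁻¹ * ((ρ ^ N)⁻¹ * (A⁻¹ * |_root_.md α (K u) (ρ⁻¹ • (z - y) - u)|))
        ≤ (ρ ^ mOrder α)⁻¹ * ((ρ ^ N)⁻¹ * ((7 / 4) ^ (N + mOrder α))⁻¹) := by
          gcongr
          exact (mul_le_mul_of_nonneg_left h1 (by positivity)).trans h2
      _ = ((7 / 4 * ρ) ^ (N + mOrder α))⁻¹ := by
          rw [mul_pow, mul_inv, pow_add ρ, mul_inv]
          ring

/-- If `u = (x - y) / t` with `y ∈ B(x, t)`, the kernels at scale `ρ ≤ t` live in `B(x, t)`. -/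
theorem closedBall_add_smul_subset_ball {x y : RN N} {t ρ : ℝ} (hρ : 0 < ρ) (hρt : ρ ≤ t)
    (hy : y ∈ ball x t) : closedBall (y + ρ • t⁻¹ • (x - y)) (ρ / 2) ⊆ ball x t := by
  have ht : 0 < t := hρ.trans_le hρt
  refine closedBall_subset_ball' ?_
  have e : y + ρ • t⁻¹ • (x - y) - x = (1 - ρ * t⁻¹) • (y - x) := by
    rw [smul_smul, sub_smul, one_smul, ← neg_sub y x, smul_neg]
    abel
  have h1 : 0 ≤ 1 - ρ * t⁻¹ := by
    rw [sub_nonneg, ← div_eq_mul_inv]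
    exact (div_le_one ht).2 hρt
  rw [dist_eq_norm, e, norm_smul, Real.norm_of_nonneg h1]
  have h2 := mul_le_mul_of_nonneg_left (mem_ball_iff_norm.1 hy).le h1
  have h3 : (1 - ρ * t⁻¹) * t = t - ρ := by
    field_simp
  linarith

/-- The maximal quantity `sup |∫_{B(x,t)} f ∂^β ψ|` of the polynomial approximation estimate. -/
def supF (L : ℕ) (f : RN N → ℂ) (x : RN N) (t : ℝ) (y : RN N) (β : Fin N → ℕ) : ℝ≥0∞ :=
  ⨆ (ψ : RN N → ℝ) (_ : ∃ s : ℝ, 0 < s ∧ s < 2 * Real.sqrt N * t ∧ ψ ∈ calF L y s),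
    ENNReal.ofReal ‖∫ z in ball x t, md β ψ z • f z‖

theorem PolyFam.exists_norm_integral_md_kern_le (hN : 1 ≤ N) {d : ℕ} {K : RN N → RN N → ℝ}
    (hK : PolyFam d K) (L : ℕ) (β : Fin N → ℕ) :
    ∃ A : ℝ, 0 < A ∧ ∀ (f : RN N → ℂ) (x y : RN N) (t ρ : ℝ), 0 < ρ → ρ ≤ t → y ∈ ball x t →
      supF L f x t y β ≠ ⊤ →
      ‖∫ z, kern y (t⁻¹ • (x - y)) ρ (_root_.md β (K (t⁻¹ • (x - y)))) z • f z‖ ≤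
        A * ρ ^ mOrder β * (supF L f x t y β).toReal := by
  obtain ⟨A, hA, h⟩ := hK.exists_kern_mem_calF L
  refine ⟨A, hA, fun f x y t ρ hρ hρt hy hfin => ?_⟩
  have ht : 0 < t := hρ.trans_le hρt
  set u := t⁻¹ • (x - y) with hu_def
  have hu : ‖u‖ ≤ 1 := by
    rw [hu_def, norm_smul, norm_inv, Real.norm_of_nonneg ht.le, norm_sub_rev]
    exact inv_mul_le_one_of_le₀ (mem_ball_iff_norm.1 hy).le ht.le
  set ψ := kern y u ρ (fun v => A⁻¹ * K u v) with hψ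
  have hKA := hK.const_mul A⁻¹
  have e1 : ∀ z, kern y u ρ (_root_.md β (K u)) z = (A * ρ ^ mOrder β) * _root_.md β ψ z := by
    intro z
    have e : _root_.md β (fun v => A⁻¹ * K u v) = fun v => A⁻¹ * _root_.md β (K u) v := by
      simpa using md_comp_affine (hK.contDiff u) A⁻¹ 1 0 β
    rw [hψ, md_kern (hKA.contDiff u), e]
    unfold kern
    field_simp
  have e2 : ∫ z in ball x t, _root_.md β ψ z • f z = ∫ z, _root_.md β ψ z • f z := by
    refine setIntegral_eq_integral_of_forall_compl_eq_zero fun z hz => ?_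
    have : z ∉ tsupport (_root_.md β ψ) := fun hz' => hz
      (closedBall_add_smul_subset_ball hρ hρt hy
        (tsupport_kern_subset hρ (hKA.tsupport_subset u) y u (tsupport_md_subset ψ β hz')))
    rw [image_eq_zero_of_notMem_tsupport this, zero_smul]
  have e3 : ‖∫ z in ball x t, _root_.md β ψ z • f z‖ ≤ (supF L f x t y β).toReal := by
    rw [← ENNReal.ofReal_le_iff_le_toReal hfin]
    refine le_iSup₂_of_le ψ ⟨7 / 4 * ρ, by positivity, ?_, h y u ρ hu hρ⟩ le_rfl
    have : 1 ≤ Real.sqrt N := Real.one_le_sqrt.2 (by exact_mod_cast hN)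
    nlinarith
  simp_rw [e1, mul_smul, integral_smul]
  rw [← e2, norm_smul, norm_smul, Real.norm_of_nonneg hA.le,
    Real.norm_of_nonneg (by positivity : 0 ≤ ρ ^ mOrder β), ← mul_assoc]
  gcongr

/-- Mean value estimate in the scale parameter for the averaged Taylor polynomials. -/
theorem exists_norm_sub_integral_kern_le (hN : 1 ≤ N) (k L : ℕ) {g : RN N → ℝ}
    (hg : ContDiff ℝ ∞ g) (hgs : tsupport g ⊆ closedBall 0 (1 / 2)) :
    ∃ C : ℝ, 0 < C ∧ ∀ f : RN N → ℂ, LocallyIntegrable f volume →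
      ∀ (x y : RN N) (t : ℝ), 0 < t → y ∈ ball x t →
      ∑ β ∈ idxEq N (k + 1), supF L f x t y β ≠ ⊤ → ∀ ε, 0 < ε → ε ≤ t →
      ‖(∫ z, kern y (t⁻¹ • (x - y)) ε (iterOp k (t⁻¹ • (x - y)) g) z • f z) -
        ∫ z, kern y (t⁻¹ • (x - y)) t (iterOp k (t⁻¹ • (x - y)) g) z • f z‖ ≤
        C * t ^ (k + 1) * (∑ β ∈ idxEq N (k + 1), supF L f x t y β).toReal := by
  obtain ⟨c, hc⟩ := divOp_iterOp (N := N) k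
  choose e he using fun β => (PolyFam.const hg hgs).shiftMonomial_mul β
  choose A hA hAb using fun β => (he β).exists_norm_integral_md_kern_le hN L β
  have hC0 : 0 ≤ ∑ β ∈ idxEq N (k + 1), |c β| * A β :=
    Finset.sum_nonneg fun β _ => mul_nonneg (abs_nonneg _) (hA β).le
  refine ⟨1 + ∑ β ∈ idxEq N (k + 1), |c β| * A β, by positivity,
    fun f hf x y t ht hy hfin ε hε hεt => ?_⟩
  set u := t⁻¹ • (x - y) with hu_def
  have hu : ‖u‖ ≤ 1 := by
    rw [hu_def, norm_smul, norm_inv, Real.norm_of_nonneg ht.le, norm_sub_rev]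
    exact inv_mul_le_one_of_le₀ (mem_ball_iff_norm.1 hy).le ht.le
  set S := (∑ β ∈ idxEq N (k + 1), supF L f x t y β).toReal with hS
  have hfin' : ∀ β ∈ idxEq N (k + 1), supF L f x t y β ≠ ⊤ := fun β hβ =>
    ((Finset.single_le_sum (fun _ _ => zero_le) hβ).trans_lt (lt_top_iff_ne_top.2 hfin)).ne
  have hSβ : ∀ β ∈ idxEq N (k + 1), (supF L f x t y β).toReal ≤ S := fun β hβ =>
    ENNReal.toReal_mono hfin (Finset.single_le_sum (f := supF L f x t y) (fun _ _ => zero_le) hβ)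
  have hiter : PolyFam (0 + k) fun u : RN N => iterOp k u g := (PolyFam.const hg hgs).iterOp k
  have hint : ∀ β ρ, 0 < ρ →
      Integrable fun z => kern y u ρ (md β (fun v => shiftMonomial u β v * g v)) z • f z := by
    intro β ρ hρ
    have h := (he β).md β
    exact hf.integrable_smul_left_of_hasCompactSupport
      (contDiff_kern (h.contDiff u) y u ρ).continuous
      (hasCompactSupport_kern hρ (h.tsupport_subset u) y u)
  have hder : ∀ ρ, 0 < ρ → ρ ≤ t →
      ‖∫ z, (-ρ⁻¹ * kern y u ρ (divOp u (iterOp k u g)) z) • f z‖ ≤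
        (∑ β ∈ idxEq N (k + 1), |c β| * A β) * t ^ k * S := by
    intro ρ hρ hρt
    have e1 : ∀ z, (-ρ⁻¹ * kern y u ρ (divOp u (iterOp k u g)) z) • f z =
        ∑ β ∈ idxEq N (k + 1), (-ρ⁻¹ * c β) •
          (kern y u ρ (md β (fun v => shiftMonomial u β v * g v)) z • f z) := by
      intro z
      simp_rw [smul_smul]
      rw [← Finset.sum_smul]
      congr 1
      unfold kern
      rw [hc u g hg, Finset.mul_sum, Finset.mul_sum]
      refine Finset.sum_congr rfl fun β _ => ?_
      ring
    have hint' : ∀ β, Integrable fun z => (-ρ⁻¹ * c β) •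
        (kern y u ρ (md β (fun v => shiftMonomial u β v * g v)) z • f z) :=
      fun β => (hint β ρ hρ).fun_smul (-ρ⁻¹ * c β)
    simp_rw [e1]
    rw [integral_finsetSum _ fun β _ => hint' β, Finset.sum_mul, Finset.sum_mul]
    refine norm_sum_le_of_le _ fun β hβ => ?_
    rw [integral_smul, norm_smul, norm_mul, norm_neg, norm_inv, Real.norm_of_nonneg hρ.le,
      Real.norm_eq_abs]
    have h1 := hAb β f x y t ρ hρ hρt hy (hfin' β hβ)
    rw [mem_idxEq.1 hβ] at h1
    have h2 := (hA β).le
    calc _ ≤ ρ⁻¹ * |c β| * (A β * ρ ^ (k + 1) * (supF L f x t y β).toReal) := by gcongr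
      _ = |c β| * A β * ρ ^ k * (supF L f x t y β).toReal := by
        rw [pow_succ]
        field_simp
      _ ≤ |c β| * A β * t ^ k * S := by
        have := hSβ β hβ
        gcongr
  have hmv := (convex_Ioc (0 : ℝ) t).norm_image_sub_le_of_norm_hasDerivWithin_le
    (fun ρ hρ => (hasDerivAt_integral_kern (hiter.contDiff u) (hiter.tsupport_subset u) hf y hu
      hρ.1).hasDerivWithinAt) (fun ρ hρ => hder ρ hρ.1 hρ.2)
    (right_mem_Ioc.2 ht) (show ε ∈ Ioc 0 t from ⟨hε, hεt⟩)
  refine hmv.trans ?_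
  have hS0 : 0 ≤ S := ENNReal.toReal_nonneg
  have h1 : ‖ε - t‖ ≤ t := by
    rw [Real.norm_eq_abs, abs_le]
    constructor <;> linarith
  calc _ ≤ (∑ β ∈ idxEq N (k + 1), |c β| * A β) * t ^ k * S * t := by gcongr
    _ = (∑ β ∈ idxEq N (k + 1), |c β| * A β) * t ^ (k + 1) * S := by ring
    _ ≤ _ := by
      gcongr
      linarith

/-- Pointwise polynomial approximation estimate (Proposition 3.2 adapted to balls). -/
theorem statement3 (N m : ℕ) (hN : 1 ≤ N) (hm : 1 ≤ m) (p : ℝ) (hp0 : 0 < p) (hp1 : p ≤ 1)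
    (T : ℝ) (hT : 0 < T) :
    ∃ C : ℝ, 0 < C ∧
      ∀ f : RN N → ℂ, LocallyIntegrable f volume →
      ∀ (x : RN N) (t : ℝ), 0 < t → t < T →
        ∃ P : RN N → ℂ, IsPolyDegLE N (m - 1) P ∧
          ∀ᵐ y ∂(volume.restrict (ball x t)),
            ENNReal.ofReal ‖f y - P y‖ ≤
              ENNReal.ofReal (C * t ^ m) *
                ∑ β ∈ idxEq N m,
                  ⨆ (ψ : RN N → ℝ) (_ : ∃ s : ℝ, 0 < s ∧ s < 2 * Real.sqrt N * t ∧
                      ψ ∈ calF (⌊(N : ℝ) * (1 / p - 1)⌋₊) y s),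
                    ENNReal.ofReal ‖∫ z in ball x t, md β ψ z • f z‖ := by
  obtain ⟨k, rfl⟩ := Nat.exists_eq_add_of_le' hm
  rw [Nat.add_sub_cancel]
  let φ : ContDiffBump (0 : RN N) := ⟨1 / 4, 1 / 2, by norm_num, by norm_num⟩
  let g : RN N → ℝ := fun v => (k.factorial : ℝ)⁻¹ * φ.normed volume v
  have hg : ContDiff ℝ ∞ g := contDiff_const.mul φ.contDiff_normed
  have hgs : tsupport g ⊆ closedBall 0 (1 / 2) :=
    (tsupport_mul_subset_right (f := fun _ => _)).trans φ.tsupport_normed_eq.subset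
  have hiter : PolyFam k fun u : RN N => iterOp k u g := by
    simpa using (PolyFam.const hg hgs).iterOp k
  have hone : ∀ u, ∫ v, iterOp k u g v = 1 := by
    intro u
    rw [integral_iterOp k (PolyFam.const hg hgs) u, integral_const_mul, φ.integral_normed, mul_one,
      mul_inv_cancel₀ (by positivity)]
  obtain ⟨C, hC, hbound⟩ :=
    exists_norm_sub_integral_kern_le hN k ⌊(N : ℝ) * (1 / p - 1)⌋₊ hg hgs
  refine ⟨C, hC, fun f hf x t ht _ => ⟨_, hiter.isPolyDegLE_integral_kern hf x ht.ne', ?_⟩⟩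
  filter_upwards [ae_restrict_of_ae (ae_tendsto_integral_kern hf),
    ae_restrict_mem measurableSet_ball] with y hlim hy
  change _ ≤ _ * ∑ β ∈ idxEq N (k + 1), supF ⌊(N : ℝ) * (1 / p - 1)⌋₊ f x t y β
  by_cases hfin : ∑ β ∈ idxEq N (k + 1), supF ⌊(N : ℝ) * (1 / p - 1)⌋₊ f x t y β = ⊤
  · rw [hfin, ENNReal.mul_top (ENNReal.ofReal_pos.2 (by positivity)).ne']
    exact le_top
  have hu : ‖t⁻¹ • (x - y)‖ ≤ 1 := by
    rw [norm_smul, norm_inv, Real.norm_of_nonneg ht.le, norm_sub_rev]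
    exact inv_mul_le_one_of_le₀ (mem_ball_iff_norm.1 hy).le ht.le
  have h1 := hlim (iterOp k (t⁻¹ • (x - y)) g) (t⁻¹ • (x - y)) (hiter.contDiff _)
    (hiter.tsupport_subset _) (hone _) hu
  have h2 := le_of_tendsto (h1.sub_const (∫ z, kern y (t⁻¹ • (x - y)) t
      (iterOp k (t⁻¹ • (x - y)) g) z • f z)).norm (by
    filter_upwards [Ioc_mem_nhdsGT ht] with ε hε
    exact hbound f hf x y t ht hy hfin ε hε.1 hε.2)
  rw [← ENNReal.ofReal_toReal hfin, ← ENNReal.ofReal_mul (by positivity)]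
  exact ENNReal.ofReal_le_ofReal h2
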